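/- Let r ≥ 1 be an integer and let g be a real function that is r-times continuously differentiable on an open interval containing [u,v], where u < v. Then ∫_u^v g^{(r)}(t) (v − t)^{r−1} dt = (v − u)^r · ∂^{r−1}/∂u^{r−1} ((g(v) − g(u))/(v − u)). Equivalently, E[g^{(r)}(B_{r,1}(u,v))] = r · _{r−1}M_0(u,v). -/

import Mathlib

theorem aux_cont (g : ℝ → ℝ) (a b : ℝ) (r : ℕ)
    (hg : ContDiffOn ℝ r g (Set.Ioo a b)) (k : ℕ) (hk : k ≤ r) :
    ContinuousOn (iteratedDeriv k g) (Set.Ioo a b) := by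
  have h := hg.continuousOn_iteratedDerivWithin (m := k) (by exact_mod_cast hk)
    isOpen_Ioo.uniqueDiffOn
  exact h.congr fun x hx => (iteratedDerivWithin_of_isOpen isOpen_Ioo hx).symm

theorem aux_deriv (g : ℝ → ℝ) (a b : ℝ) (r : ℕ)
    (hg : ContDiffOn ℝ r g (Set.Ioo a b)) (k : ℕ) (hk : k < r) (x : ℝ)
    (hx : x ∈ Set.Ioo a b) :
    HasDerivAt (iteratedDeriv k g) (iteratedDeriv (k + 1) g x) x := by
  have h := hg.differentiableOn_iteratedDerivWithin (m := k) (by exact_mod_cast hk)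
    isOpen_Ioo.uniqueDiffOn
  have h2 : DifferentiableOn ℝ (iteratedDeriv k g) (Set.Ioo a b) :=
    h.congr fun x hx => (iteratedDerivWithin_of_isOpen isOpen_Ioo hx).symm
  rw [iteratedDeriv_succ]
  exact (h2.differentiableAt (isOpen_Ioo.mem_nhds hx)).hasDerivAt

theorem aux_main (g : ℝ → ℝ) (v a b : ℝ) (hvb : v < b) (n : ℕ) :
    ContDiffOn ℝ (n + 1 : ℕ) g (Set.Ioo a b) → ∀ x, a < x → x < v →
    ∫ t in x..v, iteratedDeriv (n + 1) g t * (v - t) ^ n =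
      (v - x) ^ (n + 1) * iteratedDeriv n (fun x => (g v - g x) / (v - x)) x := by
  induction n with
  | zero =>
    intro hg x hax hxv
    have hsub : Set.uIcc x v ⊆ Set.Ioo a b := by
      rw [Set.uIcc_of_le hxv.le]
      exact fun t ht => ⟨by linarith [ht.1], by linarith [ht.2]⟩
    have h := intervalIntegral.integral_eq_sub_of_hasDerivAt (a := x) (b := v)
      (f := iteratedDeriv 0 g) (f' := iteratedDeriv (0 + 1) g)
      (fun t ht => aux_deriv g a b _ hg 0 (by omega) t (hsub ht))
      (((aux_cont g a b _ hg (0 + 1) le_rfl).mono hsub).intervalIntegrable)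
    have : v - x ≠ 0 := by linarith
    simp only [pow_zero, mul_one]
    rw [h]
    simp only [iteratedDeriv_zero]
    field_simp
    ring
  | succ n ih =>
    intro hg x hax hxv
    have hg' : ContDiffOn ℝ (n + 1 : ℕ) g (Set.Ioo a b) :=
      hg.of_le (by exact_mod_cast Nat.le_succ _)
    specialize ih hg'
    have hsub : Set.uIcc x v ⊆ Set.Ioo a b := by
      rw [Set.uIcc_of_le hxv.le]
      exact fun t ht => ⟨by linarith [ht.1], by linarith [ht.2]⟩
    have hc1 : ContinuousOn (fun t => iteratedDeriv (n + 1) g t * (v - t) ^ n) (Set.Ioo a b) :=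
      (aux_cont g a b _ hg' (n + 1) le_rfl).mul (by fun_prop)
    have hc2 : ContinuousOn (fun t => iteratedDeriv (n + 1 + 1) g t * (v - t) ^ (n + 1))
        (Set.Ioo a b) :=
      (aux_cont g a b _ hg (n + 1 + 1) le_rfl).mul (by fun_prop)
    have hp : ∀ (m : ℕ) (t : ℝ), HasDerivAt (fun t => (v - t) ^ (m + 1))
        (-((m + 1) * (v - t) ^ m)) t := by
      intro m t
      have := ((hasDerivAt_id t).const_sub v).pow (m + 1)
      refine this.congr_deriv ?_
      simp
    have hx : x ∈ Set.Ioo a b := ⟨hax, by linarith⟩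
    -- integration by parts
    have hi1 := (hc1.mono hsub).intervalIntegrable (μ := MeasureTheory.volume)
    have hi2 := (hc2.mono hsub).intervalIntegrable (μ := MeasureTheory.volume)
    have hparts := intervalIntegral.integral_eq_sub_of_hasDerivAt (a := x) (b := v)
      (f := fun t => iteratedDeriv (n + 1) g t * (v - t) ^ (n + 1))
      (f' := fun t => iteratedDeriv (n + 1 + 1) g t * (v - t) ^ (n + 1)
        - (n + 1) * (iteratedDeriv (n + 1) g t * (v - t) ^ n))
      (fun t ht => by
        refine ((aux_deriv g a b _ hg (n + 1) (by omega) t (hsub ht)).mul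
          (hp n t)).congr_deriv ?_
        ring)
      (hi2.sub (hi1.const_mul _))
    rw [intervalIntegral.integral_sub hi2 (hi1.const_mul _),
      intervalIntegral.integral_const_mul] at hparts
    -- derivative
    have hF : HasDerivAt (fun y => ∫ t in y..v, iteratedDeriv (n + 1) g t * (v - t) ^ n)
        (-(iteratedDeriv (n + 1) g x * (v - x) ^ n)) x :=
      intervalIntegral.integral_hasDerivAt_left hi1
        (hc1.stronglyMeasurableAtFilter isOpen_Ioo x hx)
        (hc1.continuousAt (isOpen_Ioo.mem_nhds hx))
    have hne : v - x ≠ 0 := by linarith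
    have hD := hF.div (hp n x) (pow_ne_zero _ hne)
    have hev : iteratedDeriv n (fun x => (g v - g x) / (v - x)) =ᶠ[nhds x]
        ((fun y => ∫ t in y..v, iteratedDeriv (n + 1) g t * (v - t) ^ n) /
          fun t => (v - t) ^ (n + 1)) := by
      filter_upwards [isOpen_Ioo.mem_nhds (show x ∈ Set.Ioo a v from ⟨hax, hxv⟩)] with y hy
      have : v - y ≠ 0 := by linarith [hy.2]
      simp only [Pi.div_apply]
      rw [ih y hy.1 hy.2]
      field_simp
    rw [iteratedDeriv_succ (n := n), hev.deriv_eq, hD.deriv]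
    have e : ∫ t in x..v, iteratedDeriv (n + 1 + 1) g t * (v - t) ^ (n + 1) =
      (n + 1) * (∫ t in x..v, iteratedDeriv (n + 1) g t * (v - t) ^ n)
        - iteratedDeriv (n + 1) g x * (v - x) ^ (n + 1) := by
      simp at hparts
      linarith
    rw [e]
    generalize (∫ t in x..v, iteratedDeriv (n + 1) g t * (v - t) ^ n) = I
    field_simp
    ring

theorem stmt_3 (g : ℝ → ℝ) (u v a b : ℝ) (r : ℕ) (hr : 1 ≤ r)
    (huv : u < v) (hau : a < u) (hvb : v < b)
    (hg : ContDiffOn ℝ r g (Set.Ioo a b)) :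
    ∫ t in u..v, iteratedDeriv r g t * (v - t) ^ (r - 1) =
      (v - u) ^ r * iteratedDeriv (r - 1) (fun x => (g v - g x) / (v - x)) u := by
  obtain ⟨n, rfl⟩ : ∃ n, r = n + 1 := ⟨r - 1, by omega⟩
  exact aux_main g v a b hvb n hg u hau huv
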